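/- arXiv:0909.5296 — 6 statements merged into one kernel-verified Lean document; each statement's English description precedes it below -/
import Mathlib

section
/- For every pair of integers 0 ≤ q ≤ p, the following identity of rational numbers holds: ∑_{j : q ≤ 2j ≤ p} 1/((2j+1)·(2j−q)!·(p−2j)!) = ∑_{l=0}^{q} (−1)^l · q! · 2^{p−q+l} / ((q−l)!·(p−q+l+1)!), where the left-hand sum ranges over all nonnegative integers j with q ≤ 2j ≤ p. -/
open Finset Nat

/-- The left-hand side with `n = p - q`, as a sum with a parity factor. -/
def gwF (q n : ℕ) : ℚ :=
  ∑ k ∈ Finset.range (n + 1),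
    ((1 + (-1 : ℚ) ^ (k + q)) / 2) / (((k : ℚ) + q + 1) * (k ! : ℚ) * ((n - k)! : ℚ))

theorem gw_parity (q n : ℕ) :
    ∑ k ∈ Finset.range (n + 2),
      ((1 + (-1 : ℚ) ^ (k + q)) / 2) / ((k ! : ℚ) * ((n + 1 - k)! : ℚ))
      = 2 ^ n / ((n + 1)! : ℚ) := by
  have h1 := add_pow (1 : ℚ) 1 (n + 1)
  have h2 := add_pow (-1 : ℚ) 1 (n + 1)
  have h3 : ∑ k ∈ Finset.range (n + 2),
      ((1 + (-1 : ℚ) ^ (k + q)) / 2) / ((k ! : ℚ) * ((n + 1 - k)! : ℚ))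
      = ∑ k ∈ Finset.range (n + 2), (1 / (2 * ((n + 1)! : ℚ)) *
          (1 ^ k * 1 ^ (n + 1 - k) * ((n + 1).choose k : ℚ)) +
          (-1) ^ q / (2 * ((n + 1)! : ℚ)) *
          ((-1) ^ k * 1 ^ (n + 1 - k) * ((n + 1).choose k : ℚ))) := by
    apply Finset.sum_congr rfl
    intro k hk
    have hk' : k ≤ n + 1 := by
      have := Finset.mem_range.mp hk
      omega
    rw [Nat.cast_choose ℚ hk']
    have a := Nat.cast_ne_zero (R := ℚ).mpr (Nat.factorial_ne_zero (n + 1))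
    have b := Nat.cast_ne_zero (R := ℚ).mpr (Nat.factorial_ne_zero k)
    have c := Nat.cast_ne_zero (R := ℚ).mpr (Nat.factorial_ne_zero (n + 1 - k))
    rw [pow_add]
    simp only [one_pow]
    field_simp
  rw [h3, Finset.sum_add_distrib, ← Finset.mul_sum, ← Finset.mul_sum, ← h1, ← h2]
  have a := Nat.cast_ne_zero (R := ℚ).mpr (Nat.factorial_ne_zero (n + 1))
  norm_num
  rw [pow_succ]
  field_simp

theorem gwF_zero (n : ℕ) : gwF 0 n = 2 ^ n / ((n + 1)! : ℚ) := by
  rw [← gw_parity 1 n, Finset.sum_range_succ', gwF]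
  simp only [zero_add, pow_one, add_neg_cancel, zero_div, add_zero]
  apply Finset.sum_congr rfl
  intro k _
  rw [Nat.add_sub_add_right, Nat.factorial_succ k, pow_succ, pow_succ]
  push_cast
  norm_num

theorem gwF_succ (q n : ℕ) :
    gwF (q + 1) n = 2 ^ n / ((n + 1)! : ℚ) - (q + 1) * gwF q (n + 1) := by
  rw [← gw_parity q n, eq_sub_iff_add_eq, gwF, gwF, Finset.mul_sum,
    Finset.sum_range_succ' _ (n + 1), Finset.sum_range_succ' _ (n + 1), ← add_assoc,
    ← Finset.sum_add_distrib]
  congr 1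
  · apply Finset.sum_congr rfl
    intro k _
    rw [Nat.add_sub_add_right, Nat.factorial_succ k, show k + 1 + q = k + (q + 1) by ring]
    have b := Nat.cast_ne_zero (R := ℚ).mpr (Nat.factorial_ne_zero k)
    have c := Nat.cast_ne_zero (R := ℚ).mpr (Nat.factorial_ne_zero (n - k))
    have d : (k : ℚ) + 1 ≠ 0 := by positivity
    have e : (k : ℚ) + (q + 1) + 1 ≠ 0 := by positivity
    have f : (k : ℚ) + 1 + q + 1 ≠ 0 := by positivity
    push_cast
    field_simp
    ring
  · have f : (q : ℚ) + 1 ≠ 0 := by positivity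
    have c := Nat.cast_ne_zero (R := ℚ).mpr (Nat.factorial_ne_zero (n + 1))
    simp
    field_simp

theorem gwF_eq (q n : ℕ) : gwF q n = ∑ l ∈ Finset.range (q + 1),
      (-1 : ℚ) ^ l * (q ! : ℚ) * 2 ^ (n + l) /
        (((q - l)! : ℚ) * ((n + l + 1)! : ℚ)) := by
  induction q generalizing n with
  | zero => rw [gwF_zero]; simp
  | succ q ih =>
    rw [gwF_succ, ih, Finset.sum_range_succ' _ (q + 1), Finset.mul_sum, sub_eq_add_neg, add_comm,
      ← Finset.sum_neg_distrib]
    congr 1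
    · apply Finset.sum_congr rfl
      intro l _
      rw [Nat.add_sub_add_right, Nat.factorial_succ q, show n + 1 + l = n + (l + 1) by ring,
        pow_succ (-1 : ℚ) l]
      push_cast
      ring
    · have c := Nat.cast_ne_zero (R := ℚ).mpr (Nat.factorial_ne_zero (q + 1))
      simp
      field_simp

/-- Lemma `lemmafactorials`: for `0 ≤ q ≤ p`,
`∑_{q ≤ 2j ≤ p} 1/((2j+1)(2j−q)!(p−2j)!) = ∑_{l=0}^{q} (−1)^l q! 2^{p−q+l}/((q−l)!(p−q+l+1)!)`. -/
theorem goncharov_wang_factorial_lemma (q p : ℕ) (hqp : q ≤ p) :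
    ∑ j ∈ (Finset.range (p + 1)).filter (fun j => q ≤ 2 * j ∧ 2 * j ≤ p),
      (1 : ℚ) / ((2 * j + 1) * ((2 * j - q)! : ℚ) * ((p - 2 * j)! : ℚ)) =
    ∑ l ∈ Finset.range (q + 1),
      (-1 : ℚ) ^ l * (q ! : ℚ) * 2 ^ (p - q + l) /
        (((q - l)! : ℚ) * ((p - q + l + 1)! : ℚ)) := by
  rw [← gwF_eq, gwF]
  have h : ∀ k ∈ Finset.range (p - q + 1),
      ((1 + (-1 : ℚ) ^ (k + q)) / 2) / (((k : ℚ) + q + 1) * (k ! : ℚ) * ((p - q - k)! : ℚ))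
      = if Even (k + q) then
        1 / (((k : ℚ) + q + 1) * (k ! : ℚ) * ((p - q - k)! : ℚ)) else 0 := by
    intro k _
    split_ifs with he
    · rw [he.neg_one_pow]; norm_num
    · rw [(Nat.not_even_iff_odd.mp he).neg_one_pow]; norm_num
  rw [Finset.sum_congr rfl h, ← Finset.sum_filter]
  refine Finset.sum_nbij' (fun j => 2 * j - q) (fun k => (k + q) / 2) ?_ ?_ ?_ ?_ ?_
  · intro j hj
    simp only [Finset.mem_filter, Finset.mem_range, Nat.even_iff] at hj ⊢
    omega
  · intro j hj
    simp only [Finset.mem_filter, Finset.mem_range, Nat.even_iff] at hj ⊢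
    omega
  · intro j hj
    simp only [Finset.mem_filter, Finset.mem_range] at hj ⊢
    omega
  · intro j hj
    simp only [Finset.mem_filter, Finset.mem_range, Nat.even_iff] at hj ⊢
    omega
  · intro j hj
    simp only [Finset.mem_filter, Finset.mem_range] at hj ⊢
    rw [show p - q - (2 * j - q) = p - 2 * j by omega, Nat.cast_sub hj.2.1]
    push_cast
    rw [sub_add_cancel]
end

section
/- For every pair of integers 0 ≤ q ≤ p, ∑_{j : q−1 ≤ 2j ≤ p} ((2j+1)!/(2j+1−q)!)·C(p+1, 2j+1) = (p+1)!·2^{p−q}/(p−q+1)!, where C(n,k) denotes the binomial coefficient and the sum ranges over all nonnegative integers j with q−1 ≤ 2j ≤ p. -/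
open Finset Nat

lemma parity_choose_sum (q n : ℕ) :
    ∑ m ∈ (Finset.range (n + 2)).filter (fun m => (m + q) % 2 = 1),
      ((n + 1).choose m : ℚ) = 2 ^ n := by
  have h1 : ∑ m ∈ Finset.range (n + 2), ((n + 1).choose m : ℚ) = 2 ^ (n + 1) := by
    exact_mod_cast Nat.sum_range_choose (n + 1)
  have h2 : ∑ m ∈ Finset.range (n + 2), (-1 : ℚ) ^ m * ((n + 1).choose m : ℚ) = 0 := by
    exact_mod_cast Int.alternating_sum_range_choose_of_ne (Nat.succ_ne_zero n)
  rw [Finset.sum_filter]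
  have h3 : ∀ m ∈ Finset.range (n + 2),
      (if (m + q) % 2 = 1 then ((n + 1).choose m : ℚ) else 0) =
      (1 / 2) * ((n + 1).choose m : ℚ)
        - (1 / 2) * (-1) ^ q * ((-1 : ℚ) ^ m * ((n + 1).choose m : ℚ)) := by
    intro m _
    have h4 : (-1 : ℚ) ^ (m + q) = (-1) ^ m * (-1) ^ q := pow_add _ _ _
    split_ifs with h
    · rw [Odd.neg_one_pow (Nat.odd_iff.mpr h)] at h4
      linear_combination (-(1 / 2) * ((n + 1).choose m : ℚ)) * h4
    · rw [Even.neg_one_pow (Nat.even_iff.mpr (by omega))] at h4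
      linear_combination (-(1 / 2) * ((n + 1).choose m : ℚ)) * h4
  rw [Finset.sum_congr rfl h3, Finset.sum_sub_distrib, ← Finset.mul_sum, ← Finset.mul_sum, h1, h2]
  ring

/-- `∑_{q−1 ≤ 2j ≤ p} ((2j+1)!/(2j+1−q)!) C(p+1, 2j+1) = (p+1)! 2^{p−q}/(p−q+1)!`. -/
theorem derivative_at_one_identity (q p : ℕ) (hqp : q ≤ p) :
    ∑ j ∈ (Finset.range (p + 1)).filter (fun j => q - 1 ≤ 2 * j ∧ 2 * j ≤ p),
      (((2 * j + 1)! : ℚ) / ((2 * j + 1 - q)! : ℚ)) * ((p + 1).choose (2 * j + 1) : ℚ) =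
    ((p + 1)! : ℚ) * 2 ^ (p - q) / ((p - q + 1)! : ℚ) := by
  rw [← parity_choose_sum q (p - q), mul_div_right_comm, Finset.mul_sum]
  refine Finset.sum_nbij' (fun j => 2 * j + 1 - q) (fun m => (m + q - 1) / 2) ?_ ?_ ?_ ?_ ?_
  · intro j hj
    simp only [Finset.mem_filter, Finset.mem_range] at hj ⊢
    omega
  · intro j hj
    simp only [Finset.mem_filter, Finset.mem_range] at hj ⊢
    omega
  · intro j hj
    simp only [Finset.mem_filter, Finset.mem_range] at hj ⊢
    omega
  · intro j hj
    simp only [Finset.mem_filter, Finset.mem_range] at hj ⊢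
    omega
  · intro j hj
    simp only [Finset.mem_filter, Finset.mem_range] at hj
    rw [Nat.cast_choose ℚ (show 2 * j + 1 ≤ p + 1 by omega),
      Nat.cast_choose ℚ (show 2 * j + 1 - q ≤ p - q + 1 by omega),
      show p - q + 1 - (2 * j + 1 - q) = p + 1 - (2 * j + 1) by omega]
    have a := fun k : ℕ => (Nat.cast_ne_zero (R := ℚ)).mpr (Nat.factorial_ne_zero k)
    have a1 := a (2 * j + 1)
    have a2 := a (2 * j + 1 - q)
    have a3 := a (p - q + 1)
    have a4 := a (p + 1 - (2 * j + 1))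
    generalize ((2 * j + 1)! : ℚ) = x1 at *
    generalize ((2 * j + 1 - q)! : ℚ) = x2 at *
    generalize ((p - q + 1)! : ℚ) = x3 at *
    generalize ((p + 1 - (2 * j + 1))! : ℚ) = x4 at *
    field_simp
end

section
/- Define, for integers 0 ≤ q ≤ p, the rational number A(q,p) = ∑_{j : q ≤ 2j ≤ p} 1/((2j+1)·(2j−q)!·(p−2j)!), the sum ranging over nonnegative integers j with q ≤ 2j ≤ p. Then for every pair of integers 1 ≤ q ≤ p, A(q,p) = 2^{p−q}/(p−q+1)! − q·A(q−1,p). -/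
open Finset Nat

/-- `A(q,p) = ∑_{q ≤ 2j ≤ p} 1/((2j+1)(2j−q)!(p−2j)!)`. -/
def A (q p : ℕ) : ℚ :=
  ∑ j ∈ (Finset.range (p + 1)).filter (fun j => q ≤ 2 * j ∧ 2 * j ≤ p),
    (1 : ℚ) / ((2 * j + 1) * ((2 * j - q)! : ℚ) * ((p - 2 * j)! : ℚ))

theorem A_parity_sum (a n : ℕ) (hn : n ≠ 0) :
    ∑ k ∈ (Finset.range (n + 1)).filter (fun k => Even (a + k)), (n.choose k : ℚ)
      = 2 ^ (n - 1) := by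
  have h1 : ∑ k ∈ Finset.range (n + 1), (n.choose k : ℚ) = 2 ^ n := by
    exact_mod_cast Nat.sum_range_choose n
  have h2 : ∑ k ∈ Finset.range (n + 1), (-1 : ℚ) ^ k * (n.choose k : ℚ) = 0 := by
    have h := Int.alternating_sum_range_choose_of_ne hn
    exact_mod_cast h
  have h3 : ∀ k ∈ Finset.range (n + 1), (if Even (a + k) then (n.choose k : ℚ) else 0)
      = 1 / 2 * (n.choose k : ℚ) + (-1) ^ a / 2 * ((-1 : ℚ) ^ k * (n.choose k : ℚ)) := by
    intro k _
    have e : (-1 : ℚ) ^ a / 2 * ((-1 : ℚ) ^ k * (n.choose k : ℚ))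
        = (-1 : ℚ) ^ (a + k) / 2 * (n.choose k : ℚ) := by rw [pow_add]; ring
    rw [e]
    split_ifs with h
    · rw [h.neg_one_pow]; ring
    · rw [(Nat.not_even_iff_odd.mp h).neg_one_pow]; ring
  rw [Finset.sum_filter, Finset.sum_congr rfl h3, Finset.sum_add_distrib, ← Finset.mul_sum,
    ← Finset.mul_sum, h1, h2]
  obtain ⟨m, rfl⟩ := Nat.exists_eq_succ_of_ne_zero hn
  simp only [Nat.succ_eq_add_one, Nat.add_sub_cancel, pow_succ]
  ring

theorem A_combined (a p : ℕ) (h : a < p) :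
    ∑ j ∈ (Finset.range (p + 1)).filter (fun j => a ≤ 2 * j ∧ 2 * j ≤ p),
      (1 : ℚ) / (((2 * j - a)! : ℚ) * ((p - 2 * j)! : ℚ))
      = 2 ^ (p - a - 1) / ((p - a)! : ℚ) := by
  rw [← A_parity_sum a (p - a) (by omega), Finset.sum_div]
  refine Finset.sum_bij' (fun j _ => 2 * j - a) (fun k _ => (a + k) / 2) ?_ ?_ ?_ ?_ ?_
  · intro j hj
    simp only [Finset.mem_filter, Finset.mem_range, Nat.even_iff] at hj ⊢
    omega
  · intro j hj
    simp only [Finset.mem_filter, Finset.mem_range, Nat.even_iff] at hj ⊢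
    omega
  · intro j hj
    simp only [Finset.mem_filter, Finset.mem_range, Nat.even_iff] at hj ⊢
    omega
  · intro j hj
    simp only [Finset.mem_filter, Finset.mem_range, Nat.even_iff] at hj ⊢
    omega
  · intro j hj
    simp only [Finset.mem_filter, Finset.mem_range] at hj
    rw [Nat.cast_choose ℚ (show 2 * j - a ≤ p - a by omega),
      show p - a - (2 * j - a) = p - 2 * j by omega]
    have := Nat.cast_ne_zero (R := ℚ).mpr (Nat.factorial_ne_zero (p - a))
    field_simp

/-- The recurrence `A(q,p) = 2^{p−q}/(p−q+1)! − q·A(q−1,p)` for `1 ≤ q ≤ p`. -/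
theorem A_recurrence (q p : ℕ) (hq : 1 ≤ q) (hqp : q ≤ p) :
    A q p = 2 ^ (p - q) / ((p - q + 1)! : ℚ) - q * A (q - 1) p := by
  obtain ⟨a, rfl⟩ : ∃ a, q = a + 1 := ⟨q - 1, by omega⟩
  have hc := A_combined a p (by omega)
  rw [show p - (a + 1) + 1 = p - a by omega, show p - (a + 1) = p - a - 1 by omega, ← hc,
    Nat.add_sub_cancel, eq_sub_iff_add_eq]
  unfold A
  rw [Finset.mul_sum, Finset.sum_filter, Finset.sum_filter, Finset.sum_filter,
    ← Finset.sum_add_distrib]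
  refine Finset.sum_congr rfl fun j _ => ?_
  have f1 := Nat.cast_ne_zero (R := ℚ).mpr (Nat.factorial_ne_zero (p - 2 * j))
  have f0 : (2 * (j : ℚ) + 1) ≠ 0 := by positivity
  by_cases h1 : a + 1 ≤ 2 * j ∧ 2 * j ≤ p
  · rw [if_pos h1, if_pos (by omega), if_pos (by omega)]
    obtain ⟨d, hd⟩ : ∃ d, 2 * j = a + 1 + d := ⟨2 * j - (a + 1), by omega⟩
    have hd' : (2 * (j : ℚ)) = a + 1 + d := by exact_mod_cast hd
    rw [show 2 * j - (a + 1) = d by omega, show 2 * j - a = d + 1 by omega, Nat.factorial_succ]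
    have f2 := Nat.cast_ne_zero (R := ℚ).mpr (Nat.factorial_ne_zero d)
    have f3 : (d : ℚ) + 1 ≠ 0 := by positivity
    push_cast
    field_simp
    linarith
  · rw [if_neg h1]
    by_cases h2 : a ≤ 2 * j ∧ 2 * j ≤ p
    · rw [if_pos h2, if_pos h2]
      have hd : 2 * j = a := by omega
      have hd' : (2 * (j : ℚ)) = a := by exact_mod_cast hd
      push_cast
      rw [← hd']
      field_simp
      simp
    · rw [if_neg h2, if_neg h2]; simp
end

section
/- For every pair of integers 1 ≤ i ≤ m, the following identity of rational numbers holds: ∑_{j : 0 ≤ 2j+1 ≤ m} ∑_{k=0}^{m−i} (1/((2j+1)!·(m−2j−1)!))·C(2j, k)·C(m−2j−1, m−i−k)·(−1)^{i+k} = (−1)^i·2^{m−1}/m!, where C(n,r) denotes the binomial coefficient (with C(n,r) = 0 for r > n or r < 0), and the outer sum ranges over all nonnegative integers j with 2j+1 ≤ m. -/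
open Finset Nat

lemma gw_odd_sum {R : Type*} [CommRing R] (a b : R) (m : ℕ) :
    2 * a * ∑ j ∈ (Finset.range (m + 1)).filter (fun j => 2 * j + 1 ≤ m),
      (m.choose (2 * j + 1) : R) * (a ^ (2 * j) * b ^ (m - 2 * j - 1)) =
    (a + b) ^ m - (-a + b) ^ m := by
  rw [add_pow, add_pow, ← Finset.sum_sub_distrib]
  have h : ∀ n ∈ Finset.range (m + 1), n ∉ (Finset.range (m + 1)).filter (fun n => Odd n) →
      a ^ n * b ^ (m - n) * (m.choose n : R) - (-a) ^ n * b ^ (m - n) * (m.choose n : R) = 0 := by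
    intro n hn hn'
    have he : Even n := by
      rw [← Nat.not_odd_iff_even]
      intro ho
      exact hn' (Finset.mem_filter.2 ⟨hn, ho⟩)
    rw [he.neg_pow, sub_self]
  rw [← Finset.sum_subset (Finset.filter_subset _ _) h, Finset.mul_sum]
  refine Finset.sum_nbij (fun j => 2 * j + 1) ?_ ?_ ?_ ?_
  · intro j hj
    simp only [Finset.mem_filter, Finset.mem_range] at hj ⊢
    exact ⟨by omega, ⟨j, rfl⟩⟩
  · intro x _ y _ hxy
    simp only at hxy
    omega
  · intro n hn
    simp only [Finset.coe_filter, Finset.mem_range, Set.mem_ofPred_eq] at hn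
    obtain ⟨h1, j, hj⟩ := hn
    refine ⟨j, ?_, hj.symm⟩
    simp only [Finset.coe_filter, Finset.mem_range, Set.mem_ofPred_eq]
    omega
  · intro j _
    have ho : Odd (2 * j + 1) := ⟨j, rfl⟩
    rw [ho.neg_pow, Nat.sub_sub]
    ring

open Polynomial in
lemma gw_poly (m : ℕ) (hm : 1 ≤ m) :
    ∑ j ∈ (Finset.range (m + 1)).filter (fun j => 2 * j + 1 ≤ m),
      (m.choose (2 * j + 1) : ℚ[X]) * ((X + C (-1)) ^ (2 * j) * (X + C 1) ^ (m - 2 * j - 1)) =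
    C (2 ^ (m - 1)) * ∑ r ∈ Finset.range m, X ^ r := by
  have h := gw_odd_sum (X + C (-1) : ℚ[X]) (X + C 1) m
  have hne : (2 * (X + C (-1)) : ℚ[X]) ≠ 0 :=
    mul_ne_zero two_ne_zero (Polynomial.X_add_C_ne_zero _)
  apply mul_left_cancel₀ hne
  rw [h]
  have hg := geom_sum_mul (X : ℚ[X]) m
  have e1 : (X + C (-1) + (X + C 1) : ℚ[X]) = 2 * X := by simp; ring
  have e2 : (-(X + C (-1)) + (X + C 1) : ℚ[X]) = 2 := by simp; ring
  have e3 : (X + C (-1) : ℚ[X]) = X - 1 := by simp; ring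
  have e4 : (C (2 ^ (m - 1)) : ℚ[X]) = 2 ^ (m - 1) := by rw [C_pow]; rfl
  rw [e1, e2, e3, e4, mul_pow]
  obtain ⟨n, rfl⟩ : ∃ n, m = n + 1 := ⟨m - 1, by omega⟩
  rw [Nat.add_sub_cancel]
  linear_combination (-(2 : ℚ[X]) ^ (n + 1)) * hg

/-- Coefficient identity showing Goncharov's form `r_{m−1}` agrees with Wang's form `T_m`:
`∑_{0≤2j+1≤m} ∑_{k=0}^{m−i} c_{j,m} C(2j,k) C(m−2j−1, m−i−k) (−1)^{i+k} = (−1)^i 2^{m−1}/m!`. -/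
theorem goncharov_wang_coefficient_identity (i m : ℕ) (hi : 1 ≤ i) (him : i ≤ m) :
    ∑ j ∈ (Finset.range (m + 1)).filter (fun j => 2 * j + 1 ≤ m),
      ∑ k ∈ Finset.range (m - i + 1),
        (1 : ℚ) / (((2 * j + 1)! : ℚ) * ((m - 2 * j - 1)! : ℚ)) *
          ((2 * j).choose k : ℚ) * ((m - 2 * j - 1).choose (m - i - k) : ℚ) *
          (-1 : ℚ) ^ (i + k) =
    (-1 : ℚ) ^ i * 2 ^ (m - 1) / (m ! : ℚ) := by
  have h := congrArg (fun p => Polynomial.coeff p (m - i)) (gw_poly m (hi.trans him))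
  simp only [Polynomial.finsetSum_coeff, Polynomial.coeff_C_mul, Polynomial.coeff_X_pow,
    Polynomial.coeff_natCast_mul, Polynomial.coeff_mul (_ ^ _),
    Finset.Nat.sum_antidiagonal_eq_sum_range_succ_mk, Polynomial.coeff_X_add_C_pow] at h
  rw [Finset.sum_ite_eq, if_pos (Finset.mem_range.2 (by omega)), mul_one] at h
  rw [← h, Finset.mul_sum, Finset.sum_div]
  refine Finset.sum_congr rfl fun j hj => ?_
  have hjm : 2 * j + 1 ≤ m := (Finset.mem_filter.1 hj).2
  rw [Finset.mul_sum, Finset.mul_sum, Finset.sum_div]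
  refine Finset.sum_congr rfl fun k _ => ?_
  by_cases hk : k ≤ 2 * j
  · have hs : (-1 : ℚ) ^ (2 * j - k) = (-1) ^ k := by
      have : (-1 : ℚ) ^ (2 * j - k) * (-1) ^ k = 1 := by
        rw [← pow_add, Nat.sub_add_cancel hk, pow_mul]; simp
      rcases neg_one_pow_eq_or ℚ k with h' | h' <;> rw [h'] at this ⊢ <;> linarith
    rw [hs, Nat.cast_choose ℚ hjm, Nat.sub_sub, one_pow, pow_add]
    have := Nat.factorial_ne_zero m
    field_simp
  · rw [Nat.choose_eq_zero_of_lt (not_le.1 hk)]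
    simp
end

section
/- For every pair of integers 1 ≤ i ≤ m, the following identity of rational numbers holds: ∑_{l=0}^{m−i} ((−1)^l·2^{i−1+l}/(i+l)!)·(∑_{k=l}^{m−i} (−1)^{i+k}/((k−l)!·(m−i−k)!)) = (−1)^i·2^{m−1}/m!. -/
open Finset Nat

theorem inner_sum_aux (i l d : ℕ) :
    (∑ k ∈ Finset.Icc l (l + d),
      (-1 : ℚ) ^ (i + k) / (((k - l)! : ℚ) * ((l + d - k)! : ℚ))) =
    if d = 0 then (-1 : ℚ) ^ (i + l) else 0 := by
  have h1 : (∑ k ∈ Finset.Icc l (l + d),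
      (-1 : ℚ) ^ (i + k) / (((k - l)! : ℚ) * ((l + d - k)! : ℚ))) =
      ∑ j ∈ Finset.range (d + 1),
        (-1 : ℚ) ^ (i + l) / (d ! : ℚ) * ((-1 : ℚ) ^ j * (d.choose j : ℚ)) := by
    rw [← Finset.Ico_add_one_right_eq_Icc, Finset.sum_Ico_eq_sum_range]
    have : l + d + 1 - l = d + 1 := by omega
    rw [this]
    refine Finset.sum_congr rfl fun j hj => ?_
    have hj' : j ≤ d := by
      have := Finset.mem_range.mp hj
      omega
    rw [Nat.cast_choose ℚ hj']
    have e1 : l + j - l = j := by omega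
    have e2 : l + d - (l + j) = d - j := by omega
    rw [e1, e2]
    have a1 : (j ! : ℚ) ≠ 0 := by exact_mod_cast Nat.factorial_ne_zero j
    have a2 : ((d - j)! : ℚ) ≠ 0 := by exact_mod_cast Nat.factorial_ne_zero (d - j)
    have a3 : (d ! : ℚ) ≠ 0 := by exact_mod_cast Nat.factorial_ne_zero d
    field_simp
    ring
  rw [h1, ← Finset.mul_sum]
  have h2 : (∑ j ∈ Finset.range (d + 1), (-1 : ℚ) ^ j * (d.choose j : ℚ)) =
      if d = 0 then 1 else 0 := by
    have := Int.alternating_sum_range_choose (n := d)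
    exact_mod_cast congrArg (Int.cast : ℤ → ℚ) this
  rw [h2]
  split_ifs with h
  · subst h
    simp
  · simp

/-- Intermediate identity in the comparison of Goncharov's and Wang's forms:
`∑_{l=0}^{m−i} ((−1)^l 2^{i−1+l}/(i+l)!) ∑_{k=l}^{m−i} (−1)^{i+k}/((k−l)!(m−i−k)!)
  = (−1)^i 2^{m−1}/m!`. -/
theorem goncharov_wang_intermediate_identity (i m : ℕ) (hi : 1 ≤ i) (him : i ≤ m) :
    ∑ l ∈ Finset.range (m - i + 1),
      (-1 : ℚ) ^ l * 2 ^ (i - 1 + l) / ((i + l)! : ℚ) *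
        (∑ k ∈ Finset.Icc l (m - i),
          (-1 : ℚ) ^ (i + k) / (((k - l)! : ℚ) * ((m - i - k)! : ℚ))) =
    (-1 : ℚ) ^ i * 2 ^ (m - 1) / (m ! : ℚ) := by
  obtain ⟨n, rfl⟩ := Nat.exists_eq_add_of_le him
  have e : i + n - i = n := by omega
  rw [e, Finset.sum_eq_single n]
  · have h := inner_sum_aux i n 0
    simp only [Nat.add_zero, if_true] at h
    rw [h]
    have e3 : i + n - 1 = i - 1 + n := by omega
    have e4 : (-1 : ℚ) ^ n * (-1) ^ n = 1 := by
      rw [← mul_pow]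
      norm_num
    rw [e3, pow_add (-1 : ℚ) i n]
    linear_combination ((-1 : ℚ) ^ i * 2 ^ (i - 1 + n) / ((i + n)! : ℚ)) * e4
  · intro l hl hne
    have hl' := Finset.mem_range.mp hl
    obtain ⟨d, rfl⟩ := Nat.exists_eq_add_of_le (show l ≤ n by omega)
    rw [inner_sum_aux, if_neg (by omega), mul_zero]
  · intro h
    exact absurd (Finset.mem_range.mpr (by omega)) h
end

section
/- Define, for integers 0 ≤ q ≤ p, the rational number A(q,p) = ∑_{j : q ≤ 2j ≤ p} 1/((2j+1)·(2j−q)!·(p−2j)!), the sum ranging over nonnegative integers j with q ≤ 2j ≤ p. Then for every pair of integers 1 ≤ q ≤ p, ∑_{j : q−1 ≤ 2j ≤ p} ((2j+1)!/(2j+1−q)!)·C(p+1, 2j+1) = q·(p+1)!·A(q−1, p) + (p+1)!·A(q, p), where C(n,k) denotes the binomial coefficient. -/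
open Finset Nat

/-- The q-th derivative at `x = 1` of `∑_{0≤2j≤p} C(p+1,2j+1)x^{2j+1}` expressed via
`A(q−1,p)` and `A(q,p)`:
`∑_{q−1 ≤ 2j ≤ p} ((2j+1)!/(2j+1−q)!) C(p+1,2j+1) = q(p+1)! A(q−1,p) + (p+1)! A(q,p)`. -/
theorem derivative_sum_split (q p : ℕ) (hq : 1 ≤ q) (hqp : q ≤ p) :
    ∑ j ∈ (Finset.range (p + 1)).filter (fun j => q - 1 ≤ 2 * j ∧ 2 * j ≤ p),
      (((2 * j + 1)! : ℚ) / ((2 * j + 1 - q)! : ℚ)) * ((p + 1).choose (2 * j + 1) : ℚ) =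
    q * ((p + 1)! : ℚ) * A (q - 1) p + ((p + 1)! : ℚ) * A q p := by
  obtain ⟨r, rfl⟩ : ∃ r, q = r + 1 := ⟨q - 1, by omega⟩
  have h2 : A (r + 1) p = ∑ j ∈ (Finset.range (p + 1)).filter (fun j => r ≤ 2 * j ∧ 2 * j ≤ p),
      ((2 * j - r : ℕ) : ℚ) / ((2 * j + 1) * ((2 * j - r)! : ℚ) * ((p - 2 * j)! : ℚ)) := by
    unfold A
    apply Finset.sum_subset_zero_on_sdiff
    · intro j hj
      simp only [Finset.mem_filter, Finset.mem_range] at hj ⊢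
      omega
    · intro j hj
      simp only [Finset.mem_sdiff, Finset.mem_filter, Finset.mem_range] at hj
      have : 2 * j - r = 0 := by omega
      simp [this]
    · intro j hj
      simp only [Finset.mem_filter, Finset.mem_range] at hj
      obtain ⟨m, hm⟩ : ∃ m, 2 * j = r + 1 + m := ⟨2 * j - (r + 1), by omega⟩
      have e1 : 2 * j - (r + 1) = m := by omega
      have e2 : 2 * j - r = m + 1 := by omega
      rw [e1, e2, Nat.factorial_succ]
      have a1 : (m ! : ℚ) ≠ 0 := by positivity
      have a2 : ((p - 2 * j)! : ℚ) ≠ 0 := by positivity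
      have a3 : (2 * (j : ℚ) + 1) ≠ 0 := by positivity
      have a4 : (m : ℚ) + 1 ≠ 0 := by positivity
      push_cast
      field_simp
  rw [h2]
  unfold A
  simp only [Nat.add_sub_cancel]
  rw [Finset.mul_sum, Finset.mul_sum, ← Finset.sum_add_distrib]
  apply Finset.sum_congr rfl
  intro j hj
  simp only [Finset.mem_filter, Finset.mem_range] at hj
  obtain ⟨m, hm⟩ : ∃ m, 2 * j = r + m := ⟨2 * j - r, by omega⟩
  have e1 : 2 * j + 1 - (r + 1) = m := by omega
  have e2 : 2 * j - r = m := by omega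
  have e3 : p + 1 - (2 * j + 1) = p - 2 * j := by omega
  rw [Nat.cast_choose ℚ (by omega : 2 * j + 1 ≤ p + 1), e1, e2, e3]
  have a1 : (m ! : ℚ) ≠ 0 := by positivity
  have a2 : ((p - 2 * j)! : ℚ) ≠ 0 := by positivity
  have a3 : (2 * (j : ℚ) + 1) ≠ 0 := by positivity
  have a4 : ((2 * j + 1)! : ℚ) ≠ 0 := by positivity
  have hm' : (2 * (j : ℚ)) = r + m := by exact_mod_cast hm
  push_cast
  field_simp
  linear_combination hm'
end
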